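/- Let u : ℝ² → ℝ be continuous such that for every z₀ in the open strip U = {z : 0 < Re z < 1} there is R > 0 with u(z₀) ≤ (1/2π)∫₀^{2π} u(z₀ + ρe^{it}) dt for all 0 < ρ < R (the sub-mean-value property), and u is bounded on the closed strip. Then for θ ∈ (0,1), u(θ) ≤ ∫_ℝ P₀(θ,t)u(it)dt + ∫_ℝ P₁(θ,t)u(1+it)dt, where P₀, P₁ are the components of the harmonic (Poisson) kernel of the strip, satisfying ∫_ℝ P₀(θ,t)dt = 1-θ and ∫_ℝ P₁(θ,t)dt = θ. -/

import Mathlib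

open MeasureTheory

namespace StripPoisson

open Set Filter Topology Real

/-- The Poisson kernel of the strip for the left line. -/
noncomputable def P (x t : ℝ) : ℝ := sin (π * x) / (2 * (cosh (π * t) - cos (π * x)))

lemma cos_lt_one {x : ℝ} (hx : x ∈ Ioo (0:ℝ) 1) : cos (π * x) < 1 := by
  have h := Real.cos_lt_cos_of_nonneg_of_le_pi (x := 0) (y := π * x) le_rfl
    (by nlinarith [pi_pos, hx.2]) (mul_pos pi_pos hx.1)
  simpa using h

lemma sin_pos' {x : ℝ} (hx : x ∈ Ioo (0:ℝ) 1) : 0 < sin (π * x) :=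
  sin_pos_of_pos_of_lt_pi (mul_pos pi_pos hx.1) (by nlinarith [pi_pos, hx.2])

lemma den_pos {x : ℝ} (hx : x ∈ Ioo (0:ℝ) 1) (t : ℝ) : 0 < cosh (π * t) - cos (π * x) := by
  linarith [cos_lt_one hx, one_le_cosh (π * t)]

lemma P_pos {x : ℝ} (hx : x ∈ Ioo (0:ℝ) 1) (t : ℝ) : 0 < P x t :=
  div_pos (sin_pos' hx) (by linarith [den_pos hx t])

lemma P_neg (x t : ℝ) : P x (-t) = P x t := by simp [P]

lemma exp_abs_le_cosh (s : ℝ) : exp |s| ≤ 2 * cosh s := by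
  rw [← cosh_abs, cosh_eq]
  have := exp_pos (-|s|)
  linarith

lemma P_le {x t q : ℝ} (hx : x ∈ Ioo (0:ℝ) 1) (hq : q < 1)
    (h : cos (π * x) ≤ q * cosh (π * t)) :
    P x t ≤ sin (π * x) * ((1 - q)⁻¹ * exp (-|t|)) := by
  have h1 : exp |t| ≤ 2 * cosh (π * t) := by
    refine le_trans (exp_le_exp.2 ?_) (exp_abs_le_cosh (π * t))
    rw [abs_mul, abs_of_pos pi_pos]
    nlinarith [abs_nonneg t, pi_gt_three]
  have h2 : (1 - q) * exp |t| ≤ 2 * (cosh (π * t) - cos (π * x)) := by nlinarith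
  have h3 : 0 < (1 - q) * exp |t| := mul_pos (by linarith) (exp_pos _)
  rw [P, div_eq_mul_inv, exp_neg, ← mul_inv]
  exact mul_le_mul_of_nonneg_left (inv_anti₀ h3 h2) (sin_pos' hx).le

lemma integrable_exp_neg_abs : Integrable (fun t : ℝ => exp (-|t|)) := by
  rw [← integrableOn_univ, ← Iic_union_Ioi (a := (0:ℝ))]
  refine IntegrableOn.union ?_ ?_
  · refine (integrableOn_exp_Iic 0).congr_fun (fun t ht => ?_) measurableSet_Iic
    simp [abs_of_nonpos (mem_Iic.1 ht)]
  · refine (integrableOn_exp_neg_Ioi 0).congr_fun (fun t ht => ?_) measurableSet_Ioi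
    simp [abs_of_pos (mem_Ioi.1 ht)]

lemma P_cont {x : ℝ} (hx : x ∈ Ioo (0:ℝ) 1) : Continuous (P x) := by
  unfold P
  refine Continuous.div (by fun_prop) (by fun_prop) fun t => ?_
  have := den_pos hx t
  positivity

lemma P_integrable {x : ℝ} (hx : x ∈ Ioo (0:ℝ) 1) : Integrable (P x) := by
  set q := max 0 (cos (π * x))
  have hq : q < 1 := max_lt one_pos (cos_lt_one hx)
  refine ((integrable_exp_neg_abs.const_mul ((1 - q)⁻¹)).const_mul (sin (π * x))).mono'
    (P_cont hx).aestronglyMeasurable (Eventually.of_forall fun t => ?_)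
  rw [norm_of_nonneg (P_pos hx t).le]
  refine P_le hx hq ?_
  have h0 : 0 ≤ q := le_max_left _ _
  have h1 : cos (π * x) ≤ q := le_max_right _ _
  nlinarith [one_le_cosh (π * t)]

lemma P_integral {x : ℝ} (hx : x ∈ Ioo (0:ℝ) 1) : ∫ t, P x t = 1 - x := by
  have hs := sin_pos' hx
  have hd : ∀ t, HasDerivAt (fun t => π⁻¹ * arctan ((exp (π * t) - cos (π * x)) / sin (π * x)))
      (P x t) t := by
    intro t
    have h1 : HasDerivAt (fun t => (exp (π * t) - cos (π * x)) / sin (π * x))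
        (exp (π * t) * (π * 1) / sin (π * x)) t :=
      ((((hasDerivAt_id t).const_mul π).exp).sub_const _).div_const _
    have h2 := (h1.arctan).const_mul π⁻¹
    refine h2.congr_deriv ?_
    have hden := den_pos hx t
    have he := exp_pos (π * t)
    have hpp := pi_pos
    have hsc := sin_sq_add_cos_sq (π * x)
    have hne : (1 + ((exp (π * t) - cos (π * x)) / sin (π * x)) ^ 2) =
       2 * exp (π * t) * (cosh (π * t) - cos (π * x)) / sin (π * x) ^ 2 := by
      rw [cosh_eq, exp_neg]
      field_simp
      linear_combination hsc
    rw [hne, P]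
    field_simp
  have htop : Tendsto (fun t => π⁻¹ * arctan ((exp (π * t) - cos (π * x)) / sin (π * x))) atTop
      (𝓝 (π⁻¹ * (π / 2))) := by
    refine Tendsto.const_mul _ ?_
    refine (tendsto_nhds_of_tendsto_nhdsWithin tendsto_arctan_atTop).comp ?_
    refine Tendsto.atTop_div_const hs ?_
    refine tendsto_atTop_add_const_right _ _ ?_
    exact tendsto_exp_atTop.comp (tendsto_id.const_mul_atTop pi_pos)
  have hbot : Tendsto (fun t => π⁻¹ * arctan ((exp (π * t) - cos (π * x)) / sin (π * x))) atBot
      (𝓝 (π⁻¹ * arctan ((0 - cos (π * x)) / sin (π * x)))) := by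
    refine Tendsto.const_mul _ ?_
    refine (continuous_arctan.tendsto _).comp ?_
    refine Tendsto.div_const ?_ _
    refine Tendsto.sub_const ?_ _
    exact tendsto_exp_atBot.comp (tendsto_id.const_mul_atBot pi_pos)
  rw [integral_of_hasDerivAt_of_tendsto hd (P_integrable hx) hbot htop]
  have : (0 - cos (π * x)) / sin (π * x) = tan (π * x - π / 2) := by
    rw [tan_eq_sin_div_cos, sin_sub_pi_div_two, cos_sub_pi_div_two]; ring
  rw [this, arctan_tan (by linarith [mul_pos pi_pos hx.1]) (by nlinarith [pi_pos, hx.2])]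
  field_simp
  ring

lemma sin_ne {z : ℂ} (hz : z.re ∈ Ioo (0:ℝ) 1) (t : ℝ) :
    Complex.sin (π / 2 * (z - t * Complex.I)) ≠ 0 := by
  intro h
  rw [Complex.sin_eq_zero_iff] at h
  obtain ⟨k, hk⟩ := h
  have := congrArg Complex.re hk
  simp at this
  have h2 : z.re = 2 * k := by
    have := pi_pos
    field_simp at *
    linarith
  rw [h2] at hz
  have a1 : (0:ℝ) < k := by linarith [hz.1]
  have a2 : (k:ℝ) < 1 := by linarith [hz.2]
  norm_cast at a1 a2
  omega

lemma P_eq_re {z : ℂ} (hz : z.re ∈ Ioo (0:ℝ) 1) (t : ℝ) :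
    P z.re (t - z.im) = (1 / 2 * (Complex.cos (π / 2 * (z - t * Complex.I)) /
      Complex.sin (π / 2 * (z - t * Complex.I)))).re := by
  have hne := sin_ne hz t
  have hden := den_pos hz (t - z.im)
  obtain ⟨x, y⟩ := z
  set a := π / 2 * x with ha
  set b := π / 2 * (y - t) with hb
  have hw : (π / 2 * ((⟨x, y⟩ : ℂ) - t * Complex.I)) = (a : ℂ) + b * Complex.I := by
    apply Complex.ext <;> simp [ha, hb]
  have h1 : π * x = 2 * a := by rw [ha]; ring
  have h2 : π * (t - y) = -(2 * b) := by rw [hb]; ring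
  rw [hw] at hne ⊢
  have hs : Complex.sin ((a : ℂ) + b * Complex.I) =
      ⟨sin a * cosh b, cos a * sinh b⟩ := by
    rw [Complex.sin_add_mul_I]
    apply Complex.ext <;> simp [← Complex.ofReal_sin, ← Complex.ofReal_cos,
      ← Complex.ofReal_sinh, ← Complex.ofReal_cosh]
  have hc : Complex.cos ((a : ℂ) + b * Complex.I) =
      ⟨cos a * cosh b, - (sin a * sinh b)⟩ := by
    rw [Complex.cos_add_mul_I]
    apply Complex.ext <;> simp [← Complex.ofReal_sin, ← Complex.ofReal_cos,
      ← Complex.ofReal_sinh, ← Complex.ofReal_cosh]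
  have hn : Complex.normSq (Complex.sin ((a : ℂ) + b * Complex.I)) =
      (cosh (2 * b) - cos (2 * a)) / 2 := by
    rw [hs, Complex.normSq_mk, cosh_two_mul, cos_two_mul]
    have e1 := sin_sq_add_cos_sq a
    have e2 := cosh_sq b
    have e3 : sin a ^ 2 = 1 - cos a ^ 2 := by linarith
    have : sin a * cosh b * (sin a * cosh b) + cos a * sinh b * (cos a * sinh b)
      = sin a ^ 2 * cosh b ^ 2 + cos a ^ 2 * sinh b ^ 2 := by ring
    rw [this, e3, e2]; ring
  have hr : (1 / 2 * (Complex.cos ((a : ℂ) + b * Complex.I) /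
      Complex.sin ((a : ℂ) + b * Complex.I))).re =
      1 / 2 * (sin a * cos a / ((cosh (2 * b) - cos (2 * a)) / 2)) := by
    have : (1 / 2 : ℂ) = ((1 / 2 : ℝ) : ℂ) := by norm_num
    rw [this, Complex.re_ofReal_mul, Complex.div_re, hn, ← add_div, hs, hc]
    have e2 := cosh_sq b
    congr 2
    simp only
    linear_combination (sin a * cos a) * e2
  rw [hr, P]
  simp only at hden ⊢
  rw [h1, h2, cosh_neg] at *
  rw [sin_two_mul]
  field_simp

lemma P_mean {z₀ : ℂ} {ρ : ℝ} (hρ : 0 < ρ)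
    (hb : ∀ z ∈ Metric.closedBall z₀ ρ, z.re ∈ Ioo (0:ℝ) 1) (t : ℝ) :
    circleAverage (fun z : ℂ => P z.re (t - z.im)) z₀ ρ = P z₀.re (t - z₀.im) := by
  set F : ℂ → ℂ := fun z => 1 / 2 * (Complex.cos (π / 2 * (z - t * Complex.I)) /
      Complex.sin (π / 2 * (z - t * Complex.I))) with hF
  have hd : ∀ z ∈ Metric.closedBall z₀ ρ, DifferentiableAt ℂ F z := by
    intro z hz
    have h1 : DifferentiableAt ℂ (fun z : ℂ => Complex.cos (π / 2 * (z - t * Complex.I))) z := by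
      fun_prop
    have h2 : DifferentiableAt ℂ (fun z : ℂ => Complex.sin (π / 2 * (z - t * Complex.I))) z := by
      fun_prop
    exact (h1.fun_div h2 (sin_ne (hb z hz) t)).const_mul _
  have hc : ContinuousOn F (Metric.closedBall z₀ ρ) := fun z hz =>
    (hd z hz).continuousAt.continuousWithinAt
  have hm : circleAverage F z₀ ρ = F z₀ := by
    refine circleAverage_of_differentiable_on_off_countable (s := ∅) countable_empty ?_ ?_
    · rwa [abs_of_pos hρ]
    · rw [abs_of_pos hρ]
      intro z hz
      exact hd z (Metric.ball_subset_closedBall hz.1)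
  have hci : CircleIntegrable F z₀ ρ :=
    (hc.mono Metric.sphere_subset_closedBall).circleIntegrable hρ.le
  have h1 := ContinuousLinearMap.circleAverage_comp_comm Complex.reCLM hci
  rw [P_eq_re (hb z₀ (Metric.mem_closedBall_self hρ.le))]
  change _ = (F z₀).re
  rw [← hm]
  rw [Complex.reCLM_apply] at h1
  rw [← h1]
  refine circleAverage_congr_sphere fun z hz => ?_
  rw [abs_of_pos hρ] at hz
  exact P_eq_re (hb z (Metric.sphere_subset_closedBall hz)) t

/-- Poisson integral. -/
noncomputable def H (f : ℝ → ℝ) (z : ℂ) : ℝ := ∫ t, P z.re (t - z.im) * f t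

/-- Poisson integral, extended to the left line. -/
noncomputable def Ht (f : ℝ → ℝ) (z : ℂ) : ℝ := if z.re ≤ 0 then f z.im else H f z

lemma P_local {z₀ : ℂ} (hz : z₀.re ∈ Ioo (0:ℝ) 1) :
    ∃ K, ∀ᶠ z : ℂ in 𝓝 z₀, z.re ∈ Ioo (0:ℝ) 1 ∧
      ∀ t, P z.re (t - z.im) ≤ K * exp (-|t|) := by
  obtain ⟨q, hq0, hq1⟩ := exists_between (max_lt one_pos (cos_lt_one hz))
  have h0 : 0 < q := lt_of_le_of_lt (le_max_left _ _) hq0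
  have hc0 : cos (π * z₀.re) < q := lt_of_le_of_lt (le_max_right _ _) hq0
  refine ⟨(1 - q)⁻¹ * exp (|z₀.im| + 1), ?_⟩
  have e1 : ∀ᶠ z : ℂ in 𝓝 z₀, z.re ∈ Ioo (0:ℝ) 1 :=
    Complex.continuous_re.continuousAt.eventually (isOpen_Ioo.mem_nhds hz)
  have e2 : ∀ᶠ z : ℂ in 𝓝 z₀, cos (π * z.re) < q := by
    have : Continuous fun z : ℂ => cos (π * z.re) := by fun_prop
    exact this.continuousAt.eventually (isOpen_Iio.mem_nhds hc0)
  have e3 : ∀ᶠ z : ℂ in 𝓝 z₀, |z.im| < |z₀.im| + 1 := by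
    have : Continuous fun z : ℂ => |z.im| := by fun_prop
    exact this.continuousAt.eventually (isOpen_Iio.mem_nhds (lt_add_one _))
  filter_upwards [e1, e2, e3] with z h1 h2 h3
  refine ⟨h1, fun t => ?_⟩
  have h4 := P_le (t := t - z.im) h1 hq1 (by nlinarith [one_le_cosh (π * (t - z.im))])
  have h5 : 0 < (1 - q)⁻¹ := inv_pos.2 (by linarith)
  have h6 : exp (-|t - z.im|) ≤ exp (|z₀.im| + 1) * exp (-|t|) := by
    rw [← exp_add]
    apply exp_le_exp.2
    have : |t| ≤ |t - z.im| + |z.im| := by simpa using abs_add_le (t - z.im) z.im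
    linarith
  calc P z.re (t - z.im) ≤ sin (π * z.re) * ((1 - q)⁻¹ * exp (-|t - z.im|)) := h4
    _ ≤ 1 * ((1 - q)⁻¹ * exp (-|t - z.im|)) := by
        gcongr
        exact sin_le_one _
    _ ≤ (1 - q)⁻¹ * exp (|z₀.im| + 1) * exp (-|t|) := by
        rw [one_mul, mul_assoc]
        gcongr

lemma P_contAt {z₀ : ℂ} (hz : z₀.re ∈ Ioo (0:ℝ) 1) (t : ℝ) :
    ContinuousAt (fun p : ℂ × ℝ => P p.1.re (p.2 - p.1.im)) (z₀, t) := by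
  unfold P
  have h1 : Continuous fun p : ℂ × ℝ => sin (π * p.1.re) := by fun_prop
  have h2 : Continuous fun p : ℂ × ℝ =>
    2 * (cosh (π * (p.2 - p.1.im)) - cos (π * p.1.re)) := by fun_prop
  refine h1.continuousAt.div h2.continuousAt ?_
  have := den_pos hz (t - z₀.im)
  simp only
  positivity

variable {f : ℝ → ℝ} {C : ℝ}

lemma integrable_Pf (hf : Continuous f) (hC : ∀ t, |f t| ≤ C) {x : ℝ}
    (hx : x ∈ Ioo (0:ℝ) 1) (y : ℝ) : Integrable fun t => P x (t - y) * f t := by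
  refine (((P_integrable hx).comp_sub_right y).mul_const C).mono' ?_ ?_
  · exact (((P_cont hx).comp (by fun_prop)).mul hf).aestronglyMeasurable
  · refine Eventually.of_forall fun t => ?_
    rw [norm_mul, norm_of_nonneg (P_pos hx _).le]
    exact mul_le_mul_of_nonneg_left (hC t) (P_pos hx _).le

lemma H_bound (hf : Continuous f) (hC : ∀ t, |f t| ≤ C) {z : ℂ}
    (hz : z.re ∈ Ioo (0:ℝ) 1) : |H f z| ≤ C * (1 - z.re) := by
  have h1 := norm_integral_le_of_norm_le (f := fun t => P z.re (t - z.im) * f t)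
    (((P_integrable hz).comp_sub_right z.im).mul_const C) (Eventually.of_forall fun t => by
      rw [norm_mul, norm_of_nonneg (P_pos hz _).le]
      exact mul_le_mul_of_nonneg_left (hC t) (P_pos hz _).le)
  rw [integral_mul_const, integral_sub_right_eq_self (P z.re), P_integral hz, mul_comm] at h1
  exact h1

lemma H_one {z : ℂ} (hz : z.re = 1) : H f z = 0 := by
  simp [H, P, hz]

lemma Ht_bound (hf : Continuous f) (hC : ∀ t, |f t| ≤ C) {z : ℂ}
    (hz : z.re ∈ Icc (0:ℝ) 1) : |Ht f z| ≤ C := by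
  have hC0 : 0 ≤ C := (abs_nonneg _).trans (hC 0)
  unfold Ht
  split_ifs with h
  · exact hC _
  · rcases hz.2.eq_or_lt with h1 | h1
    · rw [H_one h1]; simpa using hC0
    · refine (H_bound hf hC ⟨not_le.1 h, h1⟩).trans ?_
      nlinarith [hz.1]

lemma Ht_cont_int (hf : Continuous f) (hC : ∀ t, |f t| ≤ C) {z₀ : ℂ}
    (hz : z₀.re ∈ Ioo (0:ℝ) 1) : ContinuousAt (Ht f) z₀ := by
  obtain ⟨K, hK⟩ := P_local hz
  have hH : ContinuousAt (H f) z₀ := by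
    unfold H
    refine continuousAt_of_dominated (bound := fun t => K * exp (-|t|) * C) ?_ ?_ ?_ ?_
    · filter_upwards [hK] with z h
      exact (integrable_Pf hf hC h.1 _).aestronglyMeasurable
    · filter_upwards [hK] with z h
      refine Eventually.of_forall fun t => ?_
      rw [norm_mul, norm_of_nonneg (P_pos h.1 _).le]
      exact mul_le_mul (h.2 t) (hC t) (norm_nonneg _) ((P_pos h.1 _).le.trans (h.2 t))
    · exact (integrable_exp_neg_abs.const_mul K).mul_const C
    · refine Eventually.of_forall fun t => ?_
      refine ContinuousAt.mul ?_ continuousAt_const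
      exact (P_contAt hz t).comp (f := fun z : ℂ => (z, t)) (by fun_prop)
  refine hH.congr ?_
  filter_upwards [hK] with z h
  simp [Ht, not_le.2 h.1.1]

lemma Ht_cont_right (hf : Continuous f) (hC : ∀ t, |f t| ≤ C) {z₀ : ℂ}
    (hz : z₀.re = 1) : ContinuousWithinAt (Ht f) {z : ℂ | z.re ∈ Icc (0:ℝ) 1} z₀ := by
  have h0 : Ht f z₀ = 0 := by simp [Ht, hz, H_one hz]
  rw [ContinuousWithinAt, h0]
  have hev : ∀ᶠ z in 𝓝[{z : ℂ | z.re ∈ Icc (0:ℝ) 1}] z₀, ‖Ht f z‖ ≤ C * (1 - z.re) := by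
    have e1 : ∀ᶠ z : ℂ in 𝓝 z₀, 0 < z.re :=
      Complex.continuous_re.continuousAt.eventually
        (isOpen_Ioi.mem_nhds (show (0:ℝ) < z₀.re by rw [hz]; exact one_pos))
    filter_upwards [mem_nhdsWithin_of_mem_nhds e1, self_mem_nhdsWithin] with z h1 h2
    have h3 : 0 < z.re := h1
    rw [Ht, if_neg (not_le.2 h3)]
    rcases h2.2.eq_or_lt with h | h
    · simp [H_one h, h]
    · exact H_bound hf hC ⟨h3, h⟩
  refine squeeze_zero_norm' hev ?_
  have : Continuous fun z : ℂ => C * (1 - z.re) := by fun_prop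
  have h2 := (this.tendsto z₀).mono_left (nhdsWithin_le_nhds (s := {z : ℂ | z.re ∈ Icc (0:ℝ) 1}))
  simpa [hz] using h2

lemma Ht_cont_left (hf : Continuous f) (hC : ∀ t, |f t| ≤ C) {z₀ : ℂ}
    (hz : z₀.re = 0) : ContinuousWithinAt (Ht f) {z : ℂ | z.re ∈ Icc (0:ℝ) 1} z₀ := by
  have hC0 : 0 ≤ C := (abs_nonneg _).trans (hC 0)
  have h0 : Ht f z₀ = f z₀.im := by simp [Ht, hz]
  rw [Metric.continuousWithinAt_iff']
  intro ε hε
  obtain ⟨δ, hδ, hfδ⟩ := Metric.continuousAt_iff.1 (hf.continuousAt (x := z₀.im)) (ε / 2) (by linarith)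
  set q := (cosh (π * (δ / 2)))⁻¹ with hq
  have hch : 1 < cosh (π * (δ / 2)) := one_lt_cosh.2 (by positivity)
  have hq1 : q < 1 := inv_lt_one_of_one_lt₀ hch
  have hq0 : 0 < q := by positivity
  set I := ∫ t : ℝ, exp (-|t|)
  set A := 2 * C * ((1 - q)⁻¹ * I) with hA
  have e1 : ∀ᶠ z : ℂ in 𝓝 z₀, z.re < 1 :=
    Complex.continuous_re.continuousAt.eventually
        (isOpen_Iio.mem_nhds (show z₀.re < 1 by rw [hz]; exact one_pos))
  have e2 : ∀ᶠ z : ℂ in 𝓝 z₀, |z.im - z₀.im| < δ / 2 := by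
    have : Continuous fun z : ℂ => |z.im - z₀.im| := by fun_prop
    exact this.continuousAt.eventually (isOpen_Iio.mem_nhds (by simp; linarith))
  have e3 : ∀ᶠ z : ℂ in 𝓝 z₀, sin (π * z.re) * A + C * z.re < ε / 2 := by
    have : Continuous fun z : ℂ => sin (π * z.re) * A + C * z.re := by fun_prop
    exact this.continuousAt.eventually (isOpen_Iio.mem_nhds (by simp [hz]; linarith))
  filter_upwards [mem_nhdsWithin_of_mem_nhds e1, mem_nhdsWithin_of_mem_nhds e2,
    mem_nhdsWithin_of_mem_nhds e3, self_mem_nhdsWithin] with z h1 h2 h3 h4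
  have h1 : z.re < 1 := h1
  have h2 : |z.im - z₀.im| < δ / 2 := h2
  have h3 : sin (π * z.re) * A + C * z.re < ε / 2 := h3
  rw [h0, dist_eq, Ht]
  split_ifs with h
  · have := hfδ (x := z.im) (by rw [dist_eq]; linarith)
    rw [dist_eq] at this
    linarith
  have hx : z.re ∈ Ioo (0:ℝ) 1 := ⟨not_le.1 h, h1⟩
  have hPi : Integrable fun t => P z.re (t - z.im) := (P_integrable hx).comp_sub_right z.im
  have hIP : ∫ t, P z.re (t - z.im) = 1 - z.re := by
    rw [integral_sub_right_eq_self (P z.re), P_integral hx]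
  have hdec : H f z - f z₀.im =
      (∫ t, P z.re (t - z.im) * (f t - f z₀.im)) - z.re * f z₀.im := by
    simp_rw [mul_sub]
    rw [integral_sub (integrable_Pf hf hC hx _) (hPi.mul_const _), integral_mul_const, hIP, H]
    ring
  have hs := sin_pos' hx
  have hEi : Integrable fun t => 2 * C * (sin (π * z.re) * ((1 - q)⁻¹ * exp (-|t - z.im|))) :=
    (((integrable_exp_neg_abs.comp_sub_right z.im).const_mul _).const_mul _).const_mul _
  have hb : |∫ t, P z.re (t - z.im) * (f t - f z₀.im)| ≤ ε / 2 * (1 - z.re) + sin (π * z.re) * A := by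
    have hle := norm_integral_le_of_norm_le (f := fun t => P z.re (t - z.im) * (f t - f z₀.im))
      ((hPi.const_mul (ε / 2)).add hEi) (Eventually.of_forall fun t => ?_)
    · rw [norm_eq_abs] at hle
      refine hle.trans (le_of_eq ?_)
      simp only [Pi.add_apply]
      rw [integral_add (hPi.const_mul (ε / 2)) hEi, integral_const_mul, hIP, integral_const_mul,
        integral_const_mul, integral_const_mul,
        integral_sub_right_eq_self (fun t : ℝ => exp (-|t|)), hA]
      ring
    · have hP := P_pos hx (t - z.im)
      rw [norm_mul, norm_of_nonneg hP.le]
      simp only [Pi.add_apply]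
      have hnn : 0 ≤ 2 * C * (sin (π * z.re) * ((1 - q)⁻¹ * exp (-|t - z.im|))) := by
        have : 0 < (1 - q)⁻¹ := inv_pos.2 (by linarith)
        positivity
      by_cases hc : |t - z.im| < δ / 2
      · have h5 : |f t - f z₀.im| < ε / 2 := by
          have := hfδ (x := t) (by
            rw [dist_eq]
            have := abs_add_le (t - z.im) (z.im - z₀.im)
            rw [sub_add_sub_cancel] at this
            linarith)
          rwa [dist_eq] at this
        rw [norm_eq_abs]
        nlinarith
      · have h5 : P z.re (t - z.im) ≤ sin (π * z.re) * ((1 - q)⁻¹ * exp (-|t - z.im|)) := by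
          refine P_le hx hq1 ?_
          have h6 : cosh (π * (δ / 2)) ≤ cosh (π * (t - z.im)) := by
            rw [cosh_le_cosh, abs_mul, abs_mul]
            refine mul_le_mul_of_nonneg_left ?_ (abs_nonneg _)
            rw [abs_of_pos (by linarith : 0 < δ / 2)]
            exact not_lt.1 hc
          have h7 : 1 ≤ q * cosh (π * (t - z.im)) := by
            have : q * cosh (π * (δ / 2)) = 1 := by
              rw [hq]; exact inv_mul_cancel₀ (by linarith)
            nlinarith
          exact (cos_le_one _).trans h7
        have h6 : ‖f t - f z₀.im‖ ≤ 2 * C := by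
          have := norm_sub_le (f t) (f z₀.im)
          rw [norm_eq_abs (f t), norm_eq_abs (f z₀.im)] at this
          linarith [hC t, hC z₀.im]
        calc P z.re (t - z.im) * ‖f t - f z₀.im‖ ≤ P z.re (t - z.im) * (2 * C) :=
              mul_le_mul_of_nonneg_left h6 hP.le
          _ ≤ 2 * C * (sin (π * z.re) * ((1 - q)⁻¹ * exp (-|t - z.im|))) := by
              rw [mul_comm]
              exact mul_le_mul_of_nonneg_left h5 (by linarith)
          _ ≤ _ := by
              have : 0 ≤ ε / 2 * P z.re (t - z.im) := by positivity
              linarith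
  rw [hdec]
  have h8 : |z.re * f z₀.im| ≤ C * z.re := by
    rw [abs_mul, abs_of_pos hx.1, mul_comm]
    exact mul_le_mul_of_nonneg_right (hC _) hx.1.le
  have h9 := abs_sub (∫ t, P z.re (t - z.im) * (f t - f z₀.im)) (z.re * f z₀.im)
  have h10 : ε / 2 * (1 - z.re) ≤ ε / 2 := by nlinarith [hx.1]
  linarith

lemma Ht_cont (hf : Continuous f) (hC : ∀ t, |f t| ≤ C) :
    ContinuousOn (Ht f) {z : ℂ | z.re ∈ Icc (0:ℝ) 1} := by
  intro z hz
  rcases hz.1.eq_or_lt with h | h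
  · exact Ht_cont_left hf hC h.symm
  rcases hz.2.eq_or_lt with h' | h'
  · exact Ht_cont_right hf hC h'
  · exact (Ht_cont_int hf hC ⟨h, h'⟩).continuousWithinAt

lemma Ht_mean (hf : Continuous f) (hC : ∀ t, |f t| ≤ C) {z₀ : ℂ}
    (hz : z₀.re ∈ Ioo (0:ℝ) 1) :
    ∃ R > 0, ∀ ρ, 0 < ρ → ρ < R → circleAverage (Ht f) z₀ ρ = Ht f z₀ := by
  obtain ⟨K, hK⟩ := P_local hz
  obtain ⟨R, hR, hball⟩ := Metric.eventually_nhds_iff_ball.1 hK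
  refine ⟨R, hR, fun ρ hρ hρR => ?_⟩
  have hcm : ∀ θ, circleMap z₀ ρ θ ∈ Metric.ball z₀ R := fun θ =>
    Metric.closedBall_subset_ball hρR (circleMap_mem_closedBall z₀ hρ.le θ)
  have h1 : ∀ z ∈ Metric.ball z₀ R, Ht f z = H f z := fun z hz => by
    simp [Ht, not_le.2 (hball z hz).1.1]
  rw [h1 z₀ (Metric.mem_ball_self hR)]
  rw [circleAverage_def]
  simp_rw [h1 _ (hcm _), H]
  rw [MeasureTheory.intervalIntegral_integral_swap]
  · rw [← integral_smul]
    refine integral_congr_ae (Eventually.of_forall fun t => ?_)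
    simp only
    rw [intervalIntegral.integral_mul_const, smul_eq_mul, ← mul_assoc]
    congr 1
    rw [← P_mean hρ (fun z hz => (hball z (Metric.closedBall_subset_ball hρR hz)).1) t,
      circleAverage_def, smul_eq_mul]
  · have : IsFiniteMeasure (volume.restrict (uIoc 0 (2 * π))) := by
      rw [uIoc]; infer_instance
    have hb : Integrable (fun p : ℝ × ℝ => K * exp (-|p.2|) * C)
        ((volume.restrict (uIoc 0 (2 * π))).prod volume) :=
      ((integrable_exp_neg_abs.const_mul K).mul_const C).comp_snd _
    refine hb.mono' ?_ (Eventually.of_forall fun p => ?_)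
    · refine Continuous.aestronglyMeasurable ?_
      refine Continuous.mul ?_ (hf.comp continuous_snd)
      rw [continuous_iff_continuousAt]
      intro p
      exact (P_contAt (hball _ (hcm p.1)).1 p.2).comp
        (f := fun p : ℝ × ℝ => (circleMap z₀ ρ p.1, p.2))
        (((continuous_circleMap z₀ ρ).comp continuous_fst).prodMk continuous_snd).continuousAt
    · have h := hball _ (hcm p.1)
      simp only [Function.uncurry]
      rw [norm_mul, norm_of_nonneg (P_pos h.1 _).le]
      exact mul_le_mul (h.2 _) (hC _) (norm_nonneg _) ((P_pos h.1 _).le.trans (h.2 _))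

lemma Ht_mean' (hf : Continuous f) (hC : ∀ t, |f t| ≤ C) {z₀ : ℂ}
    (hz : z₀.re ∈ Ioo (0:ℝ) 1) :
    ∃ R > 0, ∀ ρ, 0 < ρ → ρ < R →
      circleAverage (fun z => Ht f (1 - z)) z₀ ρ = Ht f (1 - z₀) := by
  obtain ⟨R, hR, h⟩ := Ht_mean hf hC (z₀ := 1 - z₀) (by
    simp only [Complex.sub_re, Complex.one_re, mem_Ioo]
    constructor <;> linarith [hz.1, hz.2])
  refine ⟨R, hR, fun ρ h1 h2 => ?_⟩
  rw [← h ρ h1 h2, ← circleAverage_neg_radius, circleAverage_def, circleAverage_def]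
  congr 2
  ext θ
  congr 1
  simp [circleMap]
  ring

/-- The strictly superharmonic barrier. -/
noncomputable def B (z : ℂ) : ℝ := z.im ^ 2 - 2 * z.re ^ 2 + 2

lemma B_mean (z₀ : ℂ) (ρ : ℝ) : circleAverage B z₀ ρ = B z₀ - ρ ^ 2 / 2 := by
  rw [circleAverage_def]
  have h : ∀ θ, B (circleMap z₀ ρ θ) = (z₀.im ^ 2 - 2 * z₀.re ^ 2 + 2) +
      (2 * z₀.im * ρ) * sin θ + ρ ^ 2 * sin θ ^ 2 - (4 * z₀.re * ρ) * cos θ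
      - 2 * ρ ^ 2 * cos θ ^ 2 := by
    intro θ
    simp [B, circleMap, Complex.exp_re, Complex.exp_im]
    ring
  simp_rw [h]
  rw [intervalIntegral.integral_sub, intervalIntegral.integral_sub, intervalIntegral.integral_add,
    intervalIntegral.integral_add]
  · simp only [intervalIntegral.integral_const_mul, intervalIntegral.integral_const, integral_sin,
      integral_cos, integral_sin_sq, integral_cos_sq]
    simp [B]
    field_simp
    ring
  all_goals exact Continuous.intervalIntegrable (by fun_prop) _ _

lemma max_principle {v : ℂ → ℝ} {C : ℝ}
    (hc : ContinuousOn v {z : ℂ | z.re ∈ Icc (0:ℝ) 1})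
    (hC : ∀ z : ℂ, z.re ∈ Icc (0:ℝ) 1 → v z ≤ C)
    (h0 : ∀ z : ℂ, z.re = 0 → v z ≤ 0) (h1 : ∀ z : ℂ, z.re = 1 → v z ≤ 0)
    (hm : ∀ z₀ : ℂ, z₀.re ∈ Ioo (0:ℝ) 1 → ∃ R > 0, ∀ ρ, 0 < ρ → ρ < R →
      v z₀ ≤ circleAverage v z₀ ρ) {z : ℂ} (hz : z.re ∈ Icc (0:ℝ) 1) : v z ≤ 0 := by
  have hBc : Continuous B := by unfold B; fun_prop
  have hB : ∀ z : ℂ, z.re ∈ Icc (0:ℝ) 1 → z.im ^ 2 ≤ B z := by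
    intro z hz
    unfold B
    nlinarith [hz.1, hz.2]
  have key : ∀ ε > 0, v z ≤ ε * B z := by
    intro ε hε
    obtain ⟨M, hM⟩ : ∃ M : ℝ, C / ε + 1 + |z.im| ≤ M := ⟨_, le_rfl⟩
    set M' := max M 1
    have hM1 : 1 ≤ M' := le_max_right _ _
    have hM2 : C / ε ≤ M' := by linarith [le_max_left M 1, abs_nonneg z.im]
    set S : Set ℂ := Icc (0:ℝ) 1 ×ℂ Icc (-(M' + |z.im|)) (M' + |z.im|)
    have hS : IsCompact S := isCompact_Icc.reProdIm isCompact_Icc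
    have hzS : z ∈ S := by
      refine ⟨hz, ?_, ?_⟩ 
      · linarith [neg_abs_le z.im]
      · linarith [le_abs_self z.im]
    have hSs : S ⊆ {z : ℂ | z.re ∈ Icc (0:ℝ) 1} := fun w hw => hw.1
    have hwc : ContinuousOn (fun z => v z - ε * B z) {z : ℂ | z.re ∈ Icc (0:ℝ) 1} :=
      hc.sub (by fun_prop)
    obtain ⟨w, hwS, hw⟩ := hS.exists_isMaxOn ⟨z, hzS⟩ (hwc.mono hSs)
    suffices hle : v w - ε * B w ≤ 0 by
      have := hw hzS
      simp only [mem_ofPred_eq] at this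
      linarith
    have hwB : 0 ≤ ε * B w := mul_nonneg hε.le ((sq_nonneg _).trans (hB w hwS.1))
    rcases hwS.1.1.eq_or_lt with h | hx0
    · linarith [h0 w h.symm]
    rcases hwS.1.2.eq_or_lt with h | hx1
    · linarith [h1 w h]
    have htb : ∀ y : ℝ, M' ≤ |y| → y = w.im → v w - ε * B w ≤ 0 := by
      intro y hy hyw
      have h2 : M' ≤ B w := by
        refine le_trans ?_ (hB w hwS.1)
        rw [← hyw, ← sq_abs]
        nlinarith
      have h3 : C ≤ ε * B w := by
        have := hM2.trans h2
        rwa [div_le_iff₀' hε] at this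
      linarith [hC w hwS.1]
    by_cases hy : M' ≤ |w.im|
    · exact htb _ hy rfl
    exfalso
    have hy1 : |w.im| < M' + |z.im| := by linarith [abs_nonneg z.im]
    have hnS : S ∈ 𝓝 w := by
      have : Ioo (0:ℝ) 1 ×ℂ Ioo (-(M' + |z.im|)) (M' + |z.im|) ∈ 𝓝 w :=
        (isOpen_Ioo.reProdIm isOpen_Ioo).mem_nhds ⟨⟨hx0, hx1⟩, abs_lt.1 hy1⟩
      exact mem_of_superset this fun x hx => ⟨Ioo_subset_Icc_self hx.1, Ioo_subset_Icc_self hx.2⟩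
    obtain ⟨r, hr, hrS⟩ := Metric.nhds_basis_closedBall.mem_iff.1 hnS
    obtain ⟨R, hR, hmv⟩ := hm w ⟨hx0, hx1⟩
    obtain ⟨ρ, hρ0, hρ⟩ := exists_between (lt_min hr hR)
    have hρr : ρ < r := hρ.trans_le (min_le_left _ _)
    have hmv' := hmv ρ hρ0 (hρ.trans_le (min_le_right _ _))
    have hsph : Metric.sphere w ρ ⊆ S := fun x hx => hrS (by
      rw [Metric.mem_closedBall, Metric.mem_sphere.1 hx]; exact hρr.le)
    have hvi : CircleIntegrable v w ρ := (hc.mono (hsph.trans hSs)).circleIntegrable hρ0.le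
    have hBi : CircleIntegrable (fun z => ε • B z) w ρ :=
      (Continuous.continuousOn (by fun_prop)).circleIntegrable hρ0.le
    have hle := circleAverage_mono_on_of_le_circle (f := fun z => v z - ε • B z) (c := w) (R := ρ)
      (a := v w - ε * B w) (hvi.sub hBi) (by
        rw [abs_of_pos hρ0]
        intro x hx
        exact hw (hsph hx))
    rw [circleAverage_fun_sub hvi hBi, circleAverage_fun_smul, B_mean, smul_eq_mul] at hle
    have : 0 < ε * (ρ ^ 2 / 2) := by positivity
    nlinarith
  refine le_of_forall_pos_le_add fun ε hε => ?_
  have hBz : 0 ≤ B z := (sq_nonneg _).trans (hB z hz)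
  have := key (ε / (B z + 1)) (by positivity)
  refine this.trans ?_
  rw [zero_add, div_mul_eq_mul_div, div_le_iff₀ (by positivity)]
  nlinarith

end StripPoisson

/-- There are Poisson kernels `P₀, P₁` for the unit strip (nonnegative, with
`∫ P₀(θ,t) dt = 1-θ`, `∫ P₁(θ,t) dt = θ`) such that any bounded continuous function on
the closed strip satisfying the sub-mean-value property on the open strip satisfies
`u(θ) ≤ ∫ P₀(θ,t) u(it) dt + ∫ P₁(θ,t) u(1+it) dt`. -/
theorem subharmonic_poisson_bound_strip :
    ∃ P₀ P₁ : ℝ → ℝ → ℝ,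
      (∀ θ ∈ Set.Ioo (0:ℝ) 1,
        (∀ t, 0 ≤ P₀ θ t) ∧ (∀ t, 0 ≤ P₁ θ t) ∧
        (∫ t, P₀ θ t) = 1 - θ ∧ (∫ t, P₁ θ t) = θ) ∧
      ∀ u : ℂ → ℝ,
        ContinuousOn u {z : ℂ | z.re ∈ Set.Icc (0:ℝ) 1} →
        (∃ C : ℝ, ∀ z : ℂ, z.re ∈ Set.Icc (0:ℝ) 1 → |u z| ≤ C) →
        (∀ z₀ : ℂ, z₀.re ∈ Set.Ioo (0:ℝ) 1 → ∃ R > (0:ℝ), ∀ ρ : ℝ, 0 < ρ → ρ < R →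
          u z₀ ≤ (1 / (2 * Real.pi)) *
            ∫ t in (0:ℝ)..(2 * Real.pi), u (z₀ + (ρ : ℂ) * Complex.exp ((t : ℂ) * Complex.I))) →
        ∀ θ ∈ Set.Ioo (0:ℝ) 1,
          u (θ : ℂ) ≤ (∫ t : ℝ, P₀ θ t * u ((t : ℂ) * Complex.I)) +
            ∫ t : ℝ, P₁ θ t * u (1 + (t : ℂ) * Complex.I) := by
  have hrefl : ∀ θ ∈ Set.Ioo (0:ℝ) 1, 1 - θ ∈ Set.Ioo (0:ℝ) 1 := fun θ h =>
    ⟨by linarith [h.2], by linarith [h.1]⟩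
  refine ⟨StripPoisson.P, fun θ t => StripPoisson.P (1 - θ) t, fun θ hθ => ⟨?_, ?_, ?_, ?_⟩, ?_⟩
  · exact fun t => (StripPoisson.P_pos hθ t).le
  · exact fun t => (StripPoisson.P_pos (hrefl θ hθ) t).le
  · exact StripPoisson.P_integral hθ
  · simp only
    rw [StripPoisson.P_integral (hrefl θ hθ)]; ring
  rintro u hu ⟨C, hC⟩ hm θ hθ
  set f : ℝ → ℝ := fun t => u ((t : ℂ) * Complex.I) with hfdef
  set g : ℝ → ℝ := fun t => u (1 + ((-t : ℝ) : ℂ) * Complex.I) with hgdef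
  have hf : Continuous f := hu.comp_continuous (by fun_prop) fun t => by simp
  have hg : Continuous g := hu.comp_continuous (by fun_prop) fun t => by simp
  have hfC : ∀ t, |f t| ≤ C := fun t => hC _ (by simp)
  have hgC : ∀ t, |g t| ≤ C := fun t => hC _ (by simp)
  have hmaps : Set.MapsTo (fun z : ℂ => 1 - z) {z : ℂ | z.re ∈ Set.Icc (0:ℝ) 1}
      {z : ℂ | z.re ∈ Set.Icc (0:ℝ) 1} := by
    intro z hz
    simp only [Set.mem_ofPred_eq, Complex.sub_re, Complex.one_re, Set.mem_Icc] at hz ⊢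
    constructor <;> linarith [hz.1, hz.2]
  have hfc := StripPoisson.Ht_cont hf hfC
  have hgc : ContinuousOn (fun z => StripPoisson.Ht g (1 - z)) {z : ℂ | z.re ∈ Set.Icc (0:ℝ) 1} :=
    (StripPoisson.Ht_cont hg hgC).comp (by fun_prop) hmaps
  have hfg := hfc.add hgc
  have key := StripPoisson.max_principle (C := 3 * C)
    (v := fun z => u z - (StripPoisson.Ht f z + StripPoisson.Ht g (1 - z)))
    (hu.sub hfg) ?_ ?_ ?_ ?_ (z := (θ : ℂ)) (by simpa using ⟨hθ.1.le, hθ.2.le⟩)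
  · have e1 : StripPoisson.Ht f θ = ∫ t : ℝ, StripPoisson.P θ t * u ((t : ℂ) * Complex.I) := by
      simp [StripPoisson.Ht, StripPoisson.H, not_le.2 hθ.1, hfdef]
    have e2 : StripPoisson.Ht g (1 - θ) =
        ∫ t : ℝ, StripPoisson.P (1 - θ) t * u (1 + (t : ℂ) * Complex.I) := by
      rw [← integral_neg_eq_self]
      simp [StripPoisson.Ht, StripPoisson.H, not_le.2 hθ.2, hgdef, StripPoisson.P_neg]
    simp only [e1, e2] at key
    linarith
  · intro z hz
    have a1 := abs_le.1 (hC z hz)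
    have a2 := abs_le.1 (StripPoisson.Ht_bound hf hfC hz)
    have a3 := abs_le.1 (StripPoisson.Ht_bound hg hgC (hmaps hz))
    linarith [a1.2, a2.1, a3.1]
  · intro z hz
    have b1 : StripPoisson.Ht g (1 - z) = 0 := by
      simp [StripPoisson.Ht, hz, StripPoisson.H_one]
    have b2 : StripPoisson.Ht f z = u z := by
      simp only [StripPoisson.Ht, hz, le_refl, if_true, hfdef]
      congr 1
      apply Complex.ext <;> simp [hz]
    simp [b1, b2]
  · intro z hz
    have b1 : StripPoisson.Ht f z = 0 := by
      simp [StripPoisson.Ht, hz, StripPoisson.H_one]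
    have b2 : StripPoisson.Ht g (1 - z) = u z := by
      simp only [StripPoisson.Ht, Complex.sub_re, Complex.one_re, hz, sub_self, le_refl, if_true,
        hgdef]
      congr 1
      apply Complex.ext <;> simp [hz]
    simp [b1, b2]
  · intro z hz
    obtain ⟨R₁, hR₁, h₁⟩ := hm z hz
    obtain ⟨R₂, hR₂, h₂⟩ := StripPoisson.Ht_mean hf hfC hz
    obtain ⟨R₃, hR₃, h₃⟩ := StripPoisson.Ht_mean' hg hgC hz
    have hN : {z : ℂ | z.re ∈ Set.Ioo (0:ℝ) 1} ∈ nhds z :=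
      (isOpen_Ioo.preimage Complex.continuous_re).mem_nhds hz
    obtain ⟨R₄, hR₄, h₄⟩ := Metric.nhds_basis_closedBall.mem_iff.1 hN
    refine ⟨min (min R₁ R₂) (min R₃ R₄), by positivity, fun ρ hρ hρR => ?_⟩
    simp only [lt_min_iff] at hρR
    obtain ⟨⟨q1, q2⟩, q3, q4⟩ := hρR
    have hsph : Metric.sphere z ρ ⊆ {z : ℂ | z.re ∈ Set.Icc (0:ℝ) 1} := fun x hx =>
      Set.Ioo_subset_Icc_self (h₄ (by
        rw [Metric.mem_closedBall, Metric.mem_sphere.1 hx]; exact q4.le))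
    have i1 : CircleIntegrable u z ρ := (hu.mono hsph).circleIntegrable hρ.le
    have i2 : CircleIntegrable (StripPoisson.Ht f) z ρ := (hfc.mono hsph).circleIntegrable hρ.le
    have i3 : CircleIntegrable (fun z => StripPoisson.Ht g (1 - z)) z ρ :=
      (hgc.mono hsph).circleIntegrable hρ.le
    have i4 : CircleIntegrable (fun z => StripPoisson.Ht f z + StripPoisson.Ht g (1 - z)) z ρ :=
      i2.add i3
    rw [Real.circleAverage_fun_sub i1 i4, Real.circleAverage_fun_add i2 i3, h₂ ρ hρ q2,
      h₃ ρ hρ q3]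
    have := h₁ ρ hρ q1
    have e : Real.circleAverage u z ρ = (1 / (2 * Real.pi)) *
            ∫ t in (0:ℝ)..(2 * Real.pi), u (z + (ρ : ℂ) * Complex.exp ((t : ℂ) * Complex.I)) := by
      rw [Real.circleAverage_def, smul_eq_mul, one_div]
      rfl
    linarith
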